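/- arXiv:math/0605260 — 4 statements merged into one kernel-verified Lean document; each statement's English description precedes it below -/
import Mathlib

section
/- In the polynomial ring ℤ[x₁,x₂,x₃], the degree-4 homogeneous component of ∏_{1≤i≤j≤l≤3} (1 + xᵢ + xⱼ + x_l) equals 91e₁⁴ + 315e₁²e₂ + 189e₁e₃ + 63e₂². -/
open MvPolynomial

/-- `x₁`, `x₂`, `x₃` in `ℤ[x₁,x₂,x₃]`. -/
noncomputable def x1 : MvPolynomial (Fin 3) ℤ := X 0
noncomputable def x2 : MvPolynomial (Fin 3) ℤ := X 1
noncomputable def x3 : MvPolynomial (Fin 3) ℤ := X 2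

/-- the elementary symmetric polynomials in three variables -/
noncomputable def e1 : MvPolynomial (Fin 3) ℤ := x1 + x2 + x3
noncomputable def e2 : MvPolynomial (Fin 3) ℤ := x1*x2 + x1*x3 + x2*x3
noncomputable def e3 : MvPolynomial (Fin 3) ℤ := x1*x2*x3

/-- The product `∏_{1≤i≤j≤l≤3} (1 + xᵢ + xⱼ + x_l)` over the ten triples
`(i,j,l)` with `1 ≤ i ≤ j ≤ l ≤ 3`; by the splitting principle this is the
total Chern class of `S³E` for `E` of rank `3` with Chern roots `x₁,x₂,x₃`. -/
noncomputable def sym3Prod : MvPolynomial (Fin 3) ℤ :=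
  (1 + x1 + x1 + x1) * (1 + x1 + x1 + x2) * (1 + x1 + x1 + x3) *
  (1 + x1 + x2 + x2) * (1 + x1 + x2 + x3) * (1 + x1 + x3 + x3) *
  (1 + x2 + x2 + x2) * (1 + x2 + x2 + x3) * (1 + x2 + x3 + x3) *
  (1 + x3 + x3 + x3)

/-- Multiplying by `1 + a`, with `a` a sum of three variables, acts on homogeneous components. -/
theorem hc_step (n : ℕ) (p : MvPolynomial (Fin 3) ℤ) (i j l : Fin 3) :
    homogeneousComponent (n + 1) (p * (1 + X i + X j + X l)) =
      homogeneousComponent (n + 1) p + homogeneousComponent n p * (X i + X j + X l) := by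
  have hb : (X i + X j + X l : MvPolynomial (Fin 3) ℤ) ∈ homogeneousSubmodule (Fin 3) ℤ 1 :=
    ((isHomogeneous_X ℤ i).add (isHomogeneous_X ℤ j)).add (isHomogeneous_X ℤ l)
  have h : homogeneousComponent (n + 1) (p * (X i + X j + X l)) =
      homogeneousComponent n p * (X i + X j + X l) := by
    letI := gradedAlgebra (σ := Fin 3) (R := ℤ)
    have := DirectSum.coe_decompose_mul_of_right_mem_of_le (homogeneousSubmodule (Fin 3) ℤ)
      (a := p) (n := n + 1) hb (by omega)
    have e : ∀ (q : MvPolynomial (Fin 3) ℤ) (m : ℕ),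
        (DirectSum.decompose (homogeneousSubmodule (Fin 3) ℤ) q m : MvPolynomial (Fin 3) ℤ) =
          homogeneousComponent m q := fun q m => decomposition.decompose'_apply q m
    rwa [e, e, Nat.add_sub_cancel] at this
  rw [← h, ← map_add]
  congr 1
  ring

theorem hc_step_zero (p : MvPolynomial (Fin 3) ℤ) (i j l : Fin 3) :
    homogeneousComponent 0 (p * (1 + X i + X j + X l)) = homogeneousComponent 0 p := by
  simp [homogeneousComponent_zero, ← constantCoeff_eq]

theorem hc_one_succ (n : ℕ) :
    homogeneousComponent (n + 1) (1 : MvPolynomial (Fin 3) ℤ) = 0 :=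
  homogeneousComponent_eq_zero _ _ (by simp)

theorem hc_one_zero : homogeneousComponent 0 (1 : MvPolynomial (Fin 3) ℤ) = 1 := by
  simp

/-- The paper's formula for `c_4(S³E)`: the degree-`4` homogeneous component
of `∏_{1≤i≤j≤l≤3} (1 + xᵢ + xⱼ + x_l)`. -/
theorem chern_sym3_deg4 :
    homogeneousComponent 4 sym3Prod = 91*e1^4 + 315*e1^2*e2 + 189*e1*e3 + 63*e2^2 := by
  rw [← one_mul sym3Prod]
  simp only [sym3Prod, e1, e2, e3, x1, x2, x3, ← mul_assoc]
  rw [show (4 : ℕ) = 0 + 1 + 1 + 1 + 1 from rfl]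
  simp only [hc_step, hc_step_zero, hc_one_succ, hc_one_zero]
  ring
end

section
/- In the polynomial ring ℤ[x₁,x₂,x₃], the degree-5 homogeneous component of ∏_{1≤i≤j≤l≤3} (1 + xᵢ + xⱼ + x_l) equals 52e₁⁵ + 429e₁³e₂ + 513e₁²e₃ + 324e₁e₂² + 162e₂e₃. -/
open MvPolynomial

/-- The term `k e₁^a e₂^b e₃^c`. -/
noncomputable def T (k : ℤ) (a b c : ℕ) : MvPolynomial (Fin 3) ℤ :=
  C k * (e1 ^ a * e2 ^ b * e3 ^ c)

lemma T_homog (k : ℤ) (a b c : ℕ) : (T k a b c).IsHomogeneous (a + 2 * b + 3 * c) := by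
  have h1 : x1.IsHomogeneous 1 := isHomogeneous_X _ _
  have h2 : x2.IsHomogeneous 1 := isHomogeneous_X _ _
  have h3 : x3.IsHomogeneous 1 := isHomogeneous_X _ _
  have g1 : e1.IsHomogeneous 1 := (h1.add h2).add h3
  have g2 : e2.IsHomogeneous 2 := ((h1.mul h2).add (h1.mul h3)).add (h2.mul h3)
  have g3 : e3.IsHomogeneous 3 := (h1.mul h2).mul h3
  have h := (isHomogeneous_C (Fin 3) k).mul (((g1.pow a).mul (g2.pow b)).mul (g3.pow c))
  have he : 0 + (1 * a + 2 * b + 3 * c) = a + 2 * b + 3 * c := by ring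
  rw [he] at h
  exact h

lemma hc_T (m : ℕ) (k : ℤ) (a b c : ℕ) :
    homogeneousComponent m (T k a b c) = if m = a + 2 * b + 3 * c then T k a b c else 0 :=
  homogeneousComponent_of_mem (T_homog k a b c)

set_option maxHeartbeats 4000000 in
lemma sym3Prod_eq : sym3Prod =
    (T (1) 0 0 0) +
    (T (10) 1 0 0) +
    (T (40) 2 0 0 + T (15) 0 1 0) +
    (T (82) 3 0 0 + T (111) 1 1 0 + T (27) 0 0 1) +
    (T (91) 4 0 0 + T (315) 2 1 0 + T (63) 0 2 0 + T (189) 1 0 1) +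
    (T (52) 5 0 0 + T (429) 3 1 0 + T (324) 1 2 0 + T (513) 2 0 1 + T (162) 0 1 1) +
    (T (12) 6 0 0 + T (282) 4 1 0 + T (593) 2 2 0 + T (85) 0 3 0 + T (679) 3 0 1 + T (792) 1 1 1 + T (27) 0 0 2) +
    (T (72) 5 1 0 + T (464) 3 2 0 + T (259) 1 3 0 + T (448) 4 0 1 + T (1386) 2 1 1 + T (243) 0 2 1 + T (108) 1 0 2) +
    (T (132) 4 2 0 + T (246) 2 3 0 + T (36) 0 4 0 + T (120) 5 0 1 + T (1116) 3 1 1 + T (567) 1 2 1 + T (81) 2 0 2 + T (243) 0 1 2) +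
    (T (72) 3 3 0 + T (36) 1 4 0 + T (360) 4 1 1 + T (540) 2 2 1 + T (108) 0 3 1 + T (108) 3 0 2 + T (-243) 1 1 2 + T (729) 0 0 3) +
    (T (216) 3 2 1 + T (108) 1 3 1 + T (108) 4 0 2 + T (-486) 2 1 2 + T (729) 1 0 3) := by
  simp only [T, sym3Prod, e1, e2, e3, eq_intCast]
  push_cast
  ring

/-- The paper's formula for `c_5(S³E)`: the degree-`5` homogeneous component
of `∏_{1≤i≤j≤l≤3} (1 + xᵢ + xⱼ + x_l)`. -/
theorem chern_sym3_deg5 :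
    homogeneousComponent 5 sym3Prod = 52*e1^5 + 429*e1^3*e2 + 513*e1^2*e3 + 324*e1*e2^2 + 162*e2*e3 := by
  rw [sym3Prod_eq]
  simp only [map_add, hc_T]
  norm_num
  simp only [T, eq_intCast]
  push_cast
  ring
end

section
/- In the polynomial ring ℤ[x₁,x₂,x₃], the degree-9 homogeneous component of ∏_{1≤i≤j≤l≤3} (1 + xᵢ + xⱼ + x_l) equals 360e₁⁴e₂e₃ + 72e₁³e₂³ + 108e₁³e₃² + 540e₁²e₂²e₃ + 36e₁e₂⁴ − 243e₁e₂e₃² + 108e₂³e₃ + 729e₃³. -/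
open MvPolynomial

lemma hc_mul_linear (n : ℕ) (p l : MvPolynomial (Fin 3) ℤ) (hl : l.IsHomogeneous 1) :
    homogeneousComponent (n + 1) (p * l) = homogeneousComponent n p * l := by
  conv_lhs => rw [← sum_homogeneousComponent p, Finset.sum_mul, map_sum]
  have h : ∀ i, homogeneousComponent (n + 1) (homogeneousComponent i p * l)
      = if i = n then homogeneousComponent i p * l else 0 := by
    intro i
    rw [homogeneousComponent_of_mem ((homogeneousComponent_isHomogeneous i p).mul hl)]
    simp [eq_comm]
  simp only [h]
  rw [Finset.sum_ite_eq']
  split_ifs with hi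
  · rfl
  · rw [homogeneousComponent_eq_zero n p (by simpa using hi), zero_mul]

/-- `p` has degree at most `k+1`, top component `t`, next component `s`. -/
def TopTwo (k : ℕ) (p t s : MvPolynomial (Fin 3) ℤ) : Prop :=
  (∀ m, k + 2 ≤ m → homogeneousComponent m p = 0) ∧
    homogeneousComponent (k + 1) p = t ∧ homogeneousComponent k p = s

lemma TopTwo.step {k : ℕ} {p t s : MvPolynomial (Fin 3) ℤ} (h : TopTwo k p t s)
    {a b c : MvPolynomial (Fin 3) ℤ} (ha : a.IsHomogeneous 1) (hb : b.IsHomogeneous 1)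
    (hc : c.IsHomogeneous 1) :
    TopTwo (k + 1) (p * (1 + a + b + c)) (t * (a + b + c)) (t + s * (a + b + c)) := by
  obtain ⟨h0, h1, h2⟩ := h
  have hl : (a + b + c).IsHomogeneous 1 := (ha.add hb).add hc
  have e : p * (1 + a + b + c) = p + p * (a + b + c) := by ring
  rw [e]
  refine ⟨?_, ?_, ?_⟩
  · intro m hm
    obtain ⟨m, rfl⟩ : ∃ j, m = j + 1 := ⟨m - 1, by omega⟩
    rw [map_add, hc_mul_linear _ _ _ hl, h0 _ (by omega), h0 _ (by omega)]
    simp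
  · rw [map_add, hc_mul_linear _ _ _ hl, h0 _ (by omega), h1, zero_add]
  · rw [map_add, hc_mul_linear _ _ _ hl, h1, h2]

lemma TopTwo.base {a b c : MvPolynomial (Fin 3) ℤ} (ha : a.IsHomogeneous 1)
    (hb : b.IsHomogeneous 1) (hc : c.IsHomogeneous 1) :
    TopTwo 0 (1 + a + b + c) (a + b + c) 1 := by
  have hl : (a + b + c).IsHomogeneous 1 := (ha.add hb).add hc
  have h1 : (1 : MvPolynomial (Fin 3) ℤ).IsHomogeneous 0 := isHomogeneous_one _ _
  have e : 1 + a + b + c = 1 + (a + b + c) := by ring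
  rw [e]
  refine ⟨?_, ?_, ?_⟩
  · intro m hm
    rw [map_add, homogeneousComponent_of_mem h1, homogeneousComponent_of_mem hl,
      if_neg (by omega), if_neg (by omega), zero_add]
  · rw [map_add, homogeneousComponent_of_mem h1, homogeneousComponent_of_mem hl]
    simp
  · rw [map_add, homogeneousComponent_of_mem h1, homogeneousComponent_of_mem hl]
    simp

/-- The paper's formula for `c_9(S³E)`: the degree-`9` homogeneous component
of `∏_{1≤i≤j≤l≤3} (1 + xᵢ + xⱼ + x_l)`. -/
theorem chern_sym3_deg9 :
    homogeneousComponent 9 sym3Prod = 360*e1^4*e2*e3 + 72*e1^3*e2^3 + 108*e1^3*e3^2 + 540*e1^2*e2^2*e3 + 36*e1*e2^4 - 243*e1*e2*e3^2 + 108*e2^3*e3 + 729*e3^3 := by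
  have h1 : x1.IsHomogeneous 1 := isHomogeneous_X _ _
  have h2 : x2.IsHomogeneous 1 := isHomogeneous_X _ _
  have h3 : x3.IsHomogeneous 1 := isHomogeneous_X _ _
  have key := (((((((((TopTwo.base h1 h1 h1).step h1 h1 h2).step h1 h1 h3).step h1 h2 h2).step
    h1 h2 h3).step h1 h3 h3).step h2 h2 h2).step h2 h2 h3).step h2 h3 h3).step h3 h3 h3
  have := key.2.2
  rw [sym3Prod]
  refine this.trans ?_
  simp only [e1, e2, e3]
  ring
end

section
/- In the polynomial ring ℤ[x₁,x₂,x₃], the degree-10 homogeneous component of ∏_{1≤i≤j≤l≤3} (1 + xᵢ + xⱼ + x_l) equals 108e₁⁴e₃² + 216e₁³e₂²e₃ − 486e₁²e₂e₃² + 108e₁e₂³e₃ + 729e₁e₃³. -/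
open MvPolynomial

/-- `q` is the leading form of degree `n` of `p`. -/
def IsLeadForm (n : ℕ) (p q : MvPolynomial (Fin 3) ℤ) : Prop :=
  q.IsHomogeneous n ∧ ∃ r : MvPolynomial (Fin 3) ℤ, r.totalDegree < n ∧ p = q + r

lemma isTop_one {l : MvPolynomial (Fin 3) ℤ} (hl : l.IsHomogeneous 1) :
    IsLeadForm 1 (1 + l) l :=
  ⟨hl, 1, by simp, add_comm _ _⟩

lemma IsLeadForm.step {n : ℕ} {p q l : MvPolynomial (Fin 3) ℤ} (h : IsLeadForm n p q)
    (hl : l.IsHomogeneous 1) : IsLeadForm (n + 1) (p * (1 + l)) (q * l) := by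
  obtain ⟨hq, r, hr, rfl⟩ := h
  refine ⟨hq.mul hl, q + r * (1 + l), ?_, by ring⟩
  have h1 := totalDegree_add q (r * (1 + l))
  have h2 := totalDegree_mul r (1 + l)
  have h3 := totalDegree_add (1 : MvPolynomial (Fin 3) ℤ) l
  have h4 := hq.totalDegree_le
  have h5 := hl.totalDegree_le
  have h6 : (1 : MvPolynomial (Fin 3) ℤ).totalDegree = 0 := totalDegree_one
  omega

lemma IsLeadForm.component {n : ℕ} {p q : MvPolynomial (Fin 3) ℤ} (h : IsLeadForm n p q) :
    homogeneousComponent n p = q := by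
  obtain ⟨hq, r, hr, rfl⟩ := h
  rw [map_add, homogeneousComponent_eq_zero _ _ hr, add_zero,
    homogeneousComponent_of_mem hq, if_pos rfl]

lemma lin (i j k : Fin 3) :
    (X i + X j + X k : MvPolynomial (Fin 3) ℤ).IsHomogeneous 1 :=
  ((isHomogeneous_X _ _).add (isHomogeneous_X _ _)).add (isHomogeneous_X _ _)

/-- The paper's formula for `c_10(S³E)`: the degree-`10` homogeneous component
of `∏_{1≤i≤j≤l≤3} (1 + xᵢ + xⱼ + x_l)`. -/
theorem chern_sym3_deg10 :
    homogeneousComponent 10 sym3Prod = 108*e1^4*e3^2 + 216*e1^3*e2^2*e3 - 486*e1^2*e2*e3^2 + 108*e1*e2^3*e3 + 729*e1*e3^3 := by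
  have h := (((((((((isTop_one (lin 0 0 0)).step (lin 0 0 1)).step (lin 0 0 2)).step
    (lin 0 1 1)).step (lin 0 1 2)).step (lin 0 2 2)).step (lin 1 1 1)).step
    (lin 1 1 2)).step (lin 1 2 2)).step (lin 2 2 2)
  have h' := h.component
  simp only [← add_assoc] at h'
  unfold sym3Prod e1 e2 e3 x1 x2 x3
  refine h'.trans ?_
  ring
end
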